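/- Let n be a positive natural number, let k : Fin n → ℕ be a degree sequence with ∑_i k(i) = 2m for some m > 0, let Ξ_ij = k(i)·k(j) and M = ∑_{i,j} Ξ_ij (so M = 4m²). Then for every vertex j, working in ℚ, the expected degree of j under the undirected soft configuration model equals k(j): (∑_{A ∈ S} (∑_i A_ij) · w(A)) / C(M, m) = k(j), where S is the set of symmetric matrices A : Fin n × Fin n → ℕ with even diagonals and ∑_{i<j} A_ij + ∑_l A_ll/2 = m, and w(A) = ∏_{i<j} C(2Ξ_ij, A_ij) · ∏_l C(Ξ_ll, A_ll/2). -/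

import Mathlib

open Finset

/-- The coefficients of the power series `(1 + X) ^ c`. -/
lemma PowerSeries.coeff_one_add_X_pow_eq_choose (c k : ℕ) :
    PowerSeries.coeff k ((1 + PowerSeries.X : PowerSeries ℚ) ^ c) = (c.choose k : ℚ) := by
  rw [← Polynomial.coeff_one_add_X_pow ℚ c k, ← Polynomial.coeff_coe]
  simp

/-- The coefficients of `c X (1 + X) ^ (c - 1)`, i.e. of `X` times the derivative of
`(1 + X) ^ c`. -/
lemma PowerSeries.coeff_natCast_mul_X_mul_one_add_X_pow (c k : ℕ) :
    PowerSeries.coeff k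
      ((c : PowerSeries ℚ) * (PowerSeries.X * (1 + PowerSeries.X) ^ (c - 1))) =
      (k : ℚ) * (c.choose k : ℚ) := by
  rw [← map_natCast (PowerSeries.C (R := ℚ)), PowerSeries.coeff_C_mul]
  cases k with
  | zero => simp
  | succ k =>
    rw [PowerSeries.coeff_succ_X_mul, PowerSeries.coeff_one_add_X_pow_eq_choose]
    cases c with
    | zero => simp
    | succ c =>
      have h := Nat.add_one_mul_choose_eq c k
      rw [Nat.add_sub_cancel]
      rw [mul_comm ((k + 1 : ℕ) : ℚ)]
      exact_mod_cast h

/-- The first moment of the multivariate hypergeometric distribution, cleared of denominators. -/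
lemma sum_finsuppAntidiag_mul_prod_choose {ι : Type*} [DecidableEq ι] (s : Finset ι) (c : ι → ℕ)
    (d : ℕ) {e : ι} (he : e ∈ s) :
    (∑ l ∈ finsuppAntidiag s d, (l e : ℚ) * ∏ i ∈ s, ((c i).choose (l i) : ℚ)) *
        ((∑ i ∈ s, c i : ℕ) : ℚ) =
      c e * d * ((∑ i ∈ s, c i).choose d : ℚ) := by
  set N := ∑ i ∈ s, c i with hN
  have hNe : N = c e + ∑ i ∈ s.erase e, c i := (add_sum_erase s c he).symm
  let f : ι → PowerSeries ℚ := fun i =>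
    if i = e then (c e : PowerSeries ℚ) * (PowerSeries.X * (1 + PowerSeries.X) ^ (c e - 1))
    else (1 + PowerSeries.X) ^ c i
  have hprod : (N : PowerSeries ℚ) * ∏ i ∈ s, f i =
      (c e : PowerSeries ℚ) *
        ((N : PowerSeries ℚ) * (PowerSeries.X * (1 + PowerSeries.X) ^ (N - 1))) := by
    have h2 : ∏ i ∈ s.erase e, f i = (1 + PowerSeries.X) ^ ∑ i ∈ s.erase e, c i := by
      rw [← prod_pow_eq_pow_sum]
      exact prod_congr rfl fun i hi => if_neg (ne_of_mem_erase hi)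
    rw [← mul_prod_erase s f he, h2]
    simp only [f, if_true]
    rcases Nat.eq_zero_or_pos (c e) with h0 | h0
    · simp [h0]
    · have h3 : N - 1 = (c e - 1) + ∑ i ∈ s.erase e, c i := by omega
      rw [h3, pow_add]
      ring
  have hcoeff := congrArg (PowerSeries.coeff d) hprod
  rw [← map_natCast (PowerSeries.C (R := ℚ)) N, ← map_natCast (PowerSeries.C (R := ℚ)) (c e),
    PowerSeries.coeff_C_mul, PowerSeries.coeff_C_mul, map_natCast (PowerSeries.C (R := ℚ)) N,
    PowerSeries.coeff_natCast_mul_X_mul_one_add_X_pow, PowerSeries.coeff_prod] at hcoeff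
  rw [mul_comm, mul_assoc, ← hcoeff]
  congr 1
  refine sum_congr rfl fun l _ => ?_
  rw [← mul_prod_erase s _ he, ← mul_prod_erase s (fun i => PowerSeries.coeff (l i) (f i)) he,
    ← mul_assoc]
  congr 1
  · simp only [f, if_true, PowerSeries.coeff_natCast_mul_X_mul_one_add_X_pow]
  · refine prod_congr rfl fun i hi => ?_
    simp only [f, if_neg (ne_of_mem_erase hi), PowerSeries.coeff_one_add_X_pow_eq_choose]

/-- A product over the pairs `p.1 ≤ p.2` splits into the strict pairs and the diagonal. -/
@[to_additive]
lemma prod_filter_fst_le_snd {ι R : Type*} [Fintype ι] [LinearOrder ι] [CommMonoid R]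
    (f : ι × ι → R) :
    ∏ p with p.1 ≤ p.2, f p = (∏ p with p.1 < p.2, f p) * ∏ l, f (l, l) := by
  have h1 : ∏ l, f (l, l) = ∏ p : ι × ι with p.1 = p.2, f p := by
    refine prod_bij' (fun l _ => (l, l)) (fun p _ => p.1) ?_ ?_ ?_ ?_ ?_ <;>
      simp +contextual [Prod.ext_iff]
  rw [h1, ← prod_union]
  · refine prod_congr ?_ fun _ _ => rfl
    ext p
    simp [le_iff_lt_or_eq]
  · rw [disjoint_filter]
    exact fun p _ h => h.ne

/-- The adjacency matrix of the multigraph whose edge multiplicities are given by `B` on the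
pairs `p.1 ≤ p.2`. -/
def adjacencyOfMultiplicity {ι : Type*} [LinearOrder ι] (B : ι × ι → ℕ) (p : ι × ι) : ℕ :=
  if p.1 = p.2 then 2 * B p else B (min p.1 p.2, max p.1 p.2)

/-- The multiplicities, on the pairs `p.1 ≤ p.2`, of the multigraph with adjacency matrix `A`. -/
def multiplicityOfAdjacency {ι : Type*} [LinearOrder ι] (A : ι × ι → ℕ) (p : ι × ι) : ℕ :=
  if p.1 < p.2 then A p else if p.1 = p.2 then A p / 2 else 0

section Adjacency

variable {ι : Type*} [LinearOrder ι]

lemma adjacencyOfMultiplicity_diag (B : ι × ι → ℕ) (l : ι) :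
    adjacencyOfMultiplicity B (l, l) = 2 * B (l, l) := by
  simp [adjacencyOfMultiplicity]

lemma adjacencyOfMultiplicity_of_lt (B : ι × ι → ℕ) {p : ι × ι} (hp : p.1 < p.2) :
    adjacencyOfMultiplicity B p = B p := by
  simp [adjacencyOfMultiplicity, hp.ne, hp.le]

lemma adjacencyOfMultiplicity_symm (B : ι × ι → ℕ) (i i' : ι) :
    adjacencyOfMultiplicity B (i, i') = adjacencyOfMultiplicity B (i', i) := by
  rcases eq_or_ne i i' with rfl | h
  · rfl
  · simp [adjacencyOfMultiplicity, h, h.symm, min_comm, max_comm]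

lemma adjacencyOfMultiplicity_multiplicityOfAdjacency {A : ι × ι → ℕ}
    (hsymm : ∀ i i', A (i, i') = A (i', i)) (heven : ∀ l, 2 ∣ A (l, l)) :
    adjacencyOfMultiplicity (multiplicityOfAdjacency A) = A := by
  ext ⟨i, i'⟩
  rcases lt_trichotomy i i' with h | rfl | h
  · simp [adjacencyOfMultiplicity, multiplicityOfAdjacency, h.ne, h.le, h]
  · simp [adjacencyOfMultiplicity, multiplicityOfAdjacency, Nat.mul_div_cancel' (heven i)]
  · simp [adjacencyOfMultiplicity, multiplicityOfAdjacency, h.ne', h.le, h, hsymm i i']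

lemma multiplicityOfAdjacency_adjacencyOfMultiplicity {B : ι × ι → ℕ}
    (hB : ∀ p, B p ≠ 0 → p.1 ≤ p.2) :
    multiplicityOfAdjacency (adjacencyOfMultiplicity B) = B := by
  ext ⟨i, i'⟩
  rcases lt_trichotomy i i' with h | rfl | h
  · simp [adjacencyOfMultiplicity, multiplicityOfAdjacency, h.ne, h.le, h]
  · simp [adjacencyOfMultiplicity, multiplicityOfAdjacency]
  · have h0 : B (i, i') = 0 := by
      by_contra h0
      exact (hB _ h0).not_gt h
    simp [multiplicityOfAdjacency, h.ne', h.not_gt, h0]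

/-- The number of multi-edges is the sum of the multiplicities. -/
lemma sum_multiplicityOfAdjacency [Fintype ι] (A : ι × ι → ℕ) :
    ∑ p with p.1 ≤ p.2, multiplicityOfAdjacency A p =
      (∑ p with p.1 < p.2, A p) + ∑ l, A (l, l) / 2 := by
  rw [sum_filter_fst_le_snd]
  congr 1
  · refine sum_congr rfl fun p hp => ?_
    simp [multiplicityOfAdjacency, (mem_filter.1 hp).2]
  · simp [multiplicityOfAdjacency]

/-- Summing over adjacency matrices of multigraphs with `m` edges amounts to summing over
multiplicity functions of total mass `m`. -/
lemma sum_adjacency_eq_sum_finsuppAntidiag {n : ℕ} {R : Type*} [AddCommMonoid R] (m : ℕ)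
    (F : (Fin n × Fin n → ℕ) → R) :
    ∑ A ∈ (Fintype.piFinset fun _ : Fin n × Fin n => Finset.range (2 * m + 1)).filter
        (fun A => (∀ i i', A (i, i') = A (i', i)) ∧ (∀ l, 2 ∣ A (l, l)) ∧
          (∑ p ∈ Finset.univ.filter (fun p : Fin n × Fin n => p.1 < p.2), A p)
            + (∑ l, A (l, l) / 2) = m), F A =
      ∑ B ∈ finsuppAntidiag (univ.filter fun p : Fin n × Fin n => p.1 ≤ p.2) m,
        F (adjacencyOfMultiplicity B) := by
  refine sum_bij' (fun A _ => Finsupp.equivFunOnFinite.symm (multiplicityOfAdjacency A))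
    (fun B _ => adjacencyOfMultiplicity B) ?_ ?_ ?_ ?_ ?_
  · intro A hA
    obtain ⟨-, -, -, hsum⟩ := mem_filter.1 hA
    rw [mem_finsuppAntidiag]
    refine ⟨(sum_multiplicityOfAdjacency A).trans hsum, fun p hp => ?_⟩
    rw [Finsupp.mem_support_iff, Finsupp.equivFunOnFinite_symm_apply_apply] at hp
    rw [mem_filter]
    refine ⟨mem_univ _, not_lt.1 fun h => hp ?_⟩
    simp [multiplicityOfAdjacency, h.not_gt, h.ne']
  · intro B hB
    obtain ⟨hsum, hsupp⟩ := mem_finsuppAntidiag.1 hB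
    have hle : ∀ p, B p ≤ m := fun p => by
      by_cases hp : p ∈ B.support
      · exact hsum ▸ single_le_sum (f := fun p => B p) (fun _ _ => Nat.zero_le _) (hsupp hp)
      · simp [Finsupp.notMem_support_iff.1 hp]
    rw [mem_filter, Fintype.mem_piFinset]
    refine ⟨fun p => ?_, adjacencyOfMultiplicity_symm _, fun l => ?_, ?_⟩
    · rw [mem_range, adjacencyOfMultiplicity]
      split_ifs
      · have := hle p
        omega
      · have := hle (min p.1 p.2, max p.1 p.2)
        omega
    · rw [adjacencyOfMultiplicity_diag]
      exact dvd_mul_right _ _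
    · rw [← sum_multiplicityOfAdjacency, multiplicityOfAdjacency_adjacencyOfMultiplicity, hsum]
      exact fun p hp => (mem_filter.1 (hsupp (Finsupp.mem_support_iff.2 hp))).2
  · intro A hA
    obtain ⟨-, hsymm, heven, -⟩ := mem_filter.1 hA
    exact adjacencyOfMultiplicity_multiplicityOfAdjacency hsymm heven
  · intro B hB
    obtain ⟨-, hsupp⟩ := mem_finsuppAntidiag.1 hB
    ext p
    rw [Finsupp.equivFunOnFinite_symm_apply_apply,
      multiplicityOfAdjacency_adjacencyOfMultiplicity]
    exact fun p hp => (mem_filter.1 (hsupp (Finsupp.mem_support_iff.2 hp))).2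
  · intro A hA
    obtain ⟨-, hsymm, heven, -⟩ := mem_filter.1 hA
    exact congrArg F (adjacencyOfMultiplicity_multiplicityOfAdjacency hsymm heven).symm

end Adjacency

/-- The expected degree sequence of the undirected soft configuration model induced
by a degree sequence `k` with `∑ k = 2m` (combinatorial matrix `Ξ_ij = k i * k j`,
`M = ∑_{i,j} Ξ_ij`) coincides with `k`: for every vertex `j`,
`E[k_j(X)] = k j`. -/
theorem undirectedSoftConfigurationModel_expected_degrees
    (n : ℕ) (hn : 0 < n) (k : Fin n → ℕ) (m : ℕ) (hm : 0 < m)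
    (hk : ∑ i, k i = 2 * m)
    (Ξ : Fin n × Fin n → ℕ) (hΞ : ∀ p, Ξ p = k p.1 * k p.2)
    (M : ℕ) (hM : M = ∑ p, Ξ p) :
    ∀ j : Fin n,
      (∑ A ∈ (Fintype.piFinset fun _ : Fin n × Fin n => Finset.range (2 * m + 1)).filter
          (fun A => (∀ i i', A (i, i') = A (i', i)) ∧ (∀ l, 2 ∣ A (l, l)) ∧
            (∑ p ∈ Finset.univ.filter (fun p : Fin n × Fin n => p.1 < p.2), A p)
              + (∑ l, A (l, l) / 2) = m),
        ((∑ i, A (i, j) : ℕ) : ℚ) *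
          ((∏ p ∈ Finset.univ.filter (fun p : Fin n × Fin n => p.1 < p.2),
              ((2 * Ξ p).choose (A p) : ℚ))
            * ∏ l, ((Ξ (l, l)).choose (A (l, l) / 2) : ℚ))) / (M.choose m : ℚ)
        = (k j : ℚ) := by
  intro j
  have hMm : M = 4 * m ^ 2 := by
    rw [hM, Fintype.sum_prod_type]
    simp only [hΞ]
    rw [← Fintype.sum_mul_sum, hk]
    ring
  have hchoose : (M.choose m : ℚ) ≠ 0 := by
    have : m ≤ M := by nlinarith
    exact_mod_cast (Nat.choose_pos this).ne'
  have hM0 : (M : ℚ) ≠ 0 := by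
    have : 0 < M := by rw [hMm]; positivity
    exact_mod_cast this.ne'
  have hΞsymm : ∀ p : Fin n × Fin n, Ξ p.swap = Ξ p := fun p => by
    rw [hΞ, hΞ, Prod.fst_swap, Prod.snd_swap, mul_comm]
  let c : Fin n × Fin n → ℕ := fun p => if p.1 = p.2 then Ξ p else 2 * Ξ p
  have hc : ∑ p with p.1 ≤ p.2, c p = M := by
    have hlt : ∑ p : Fin n × Fin n with p.1 < p.2, c p = ∑ p with p.1 < p.2, 2 * Ξ p :=
      sum_congr rfl fun p hp => if_neg (mem_filter.1 hp).2.ne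
    have hgt : ∑ p : Fin n × Fin n with ¬ p.1 ≤ p.2, Ξ p = ∑ p with p.1 < p.2, Ξ p := by
      refine sum_bij' (fun p _ => p.swap) (fun p _ => p.swap) ?_ ?_ ?_ ?_ ?_ <;>
        simp [hΞsymm]
    rw [sum_filter_fst_le_snd, hlt, hM, ← sum_filter_add_sum_filter_not univ
      (fun p : Fin n × Fin n => p.1 ≤ p.2), hgt, sum_filter_fst_le_snd, ← mul_sum]
    simp only [c, if_true]
    ring
  let e : Fin n → Fin n × Fin n := fun i => (min i j, max i j)
  have hadj : ∀ (B : Fin n × Fin n → ℕ) (i : Fin n),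
      adjacencyOfMultiplicity B (i, j) = (if i = j then 2 else 1) * B (e i) := by
    intro B i
    rcases eq_or_ne i j with rfl | h
    · simp [adjacencyOfMultiplicity, e]
    · simp [adjacencyOfMultiplicity, e, h]
  have hce : ∀ i, (if i = j then 2 else 1) * c (e i) = 2 * (k i * k j) := by
    intro i
    rcases lt_trichotomy i j with h | rfl | h
    · simp [c, e, hΞ, h.le, h.ne]
    · simp [c, e, hΞ]
    · simp [c, e, hΞ, h.le, h.ne, h.ne', mul_comm]
  have hweight : ∀ B : Fin n × Fin n → ℕ,
      (∏ p ∈ univ.filter (fun p : Fin n × Fin n => p.1 < p.2),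
          ((2 * Ξ p).choose (adjacencyOfMultiplicity B p) : ℚ)) *
        ∏ l, ((Ξ (l, l)).choose (adjacencyOfMultiplicity B (l, l) / 2) : ℚ) =
      ∏ p with p.1 ≤ p.2, ((c p).choose (B p) : ℚ) := by
    intro B
    rw [prod_filter_fst_le_snd]
    congr 1
    · refine prod_congr rfl fun p hp => ?_
      have hp := (mem_filter.1 hp).2
      simp [adjacencyOfMultiplicity_of_lt B hp, c, hp.ne]
    · simp [adjacencyOfMultiplicity_diag, c]
  rw [sum_adjacency_eq_sum_finsuppAntidiag, div_eq_iff hchoose]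
  simp only [hweight, hadj]
  apply mul_right_cancel₀ hM0
  have hmoment : ∀ i, (∑ B ∈ finsuppAntidiag (univ.filter fun p : Fin n × Fin n => p.1 ≤ p.2) m,
      (B (e i) : ℚ) * ∏ p with p.1 ≤ p.2, ((c p).choose (B p) : ℚ)) * (M : ℚ) =
      c (e i) * m * (M.choose m : ℚ) := by
    intro i
    have h := sum_finsuppAntidiag_mul_prod_choose
      (univ.filter fun p : Fin n × Fin n => p.1 ≤ p.2) c m (e := e i) (by simp [e])
    rwa [hc] at h
  have hsum : ∑ i, (((if i = j then 2 else 1 : ℕ) : ℚ) * (c (e i) : ℚ)) = 4 * m * k j := by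
    have h : ∑ i, (if i = j then 2 else 1) * c (e i) = 4 * m * k j := by
      simp only [hce]
      rw [← mul_sum, ← sum_mul, hk]
      ring
    exact_mod_cast h
  calc _ = ∑ i, ((if i = j then 2 else 1 : ℕ) : ℚ) *
        ((∑ B ∈ finsuppAntidiag (univ.filter fun p : Fin n × Fin n => p.1 ≤ p.2) m,
          (B (e i) : ℚ) * ∏ p with p.1 ≤ p.2, ((c p).choose (B p) : ℚ)) * (M : ℚ)) := by
        simp only [Nat.cast_sum, Nat.cast_mul, sum_mul, mul_sum]
        rw [sum_comm]
        simp only [mul_assoc]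
    _ = (∑ i, (((if i = j then 2 else 1 : ℕ) : ℚ) * (c (e i) : ℚ))) * (m * M.choose m) := by
        rw [sum_mul]
        refine sum_congr rfl fun i _ => ?_
        rw [hmoment]
        ring
    _ = _ := by
        rw [hsum, hMm]
        push_cast
        ring
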